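/- arXiv:2601.15996 — 2 statements merged into one kernel-verified Lean document; each statement's English description precedes it below -/
import Mathlib

section
/- Fix ρ > 0. Define β*₀ = 0, R*₀ = 1 and, recursively, β*_n = B_ρ(R*_{n−1}) and R*_n = V_ρ(R*_{n−1}) for n ≥ 1. Then: (i) for every n ≥ 1, R*_n equals the global minimum of R_n(β₁,…,β_n) over [0,1]^n, attained at (β*₁,…,β*_n); (ii) β*_n = min{1, (1 + (ρ β*_{n−1})²)/(2ρ)} for all n ≥ 1; (iii) the sequence (R*_n) is strictly decreasing and converges to r_ρ = max{0, 1 − 1/ρ}. -/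
/-- The recursive bound `c_n`. -/
noncomputable def cSeq (ρ : ℝ) (β : ℕ → ℝ) : ℕ → ℝ
  | 0 => 0
  | n + 1 => min 1 (ρ * (|β n - β (n + 1)| + min (β n) (β (n + 1)) * cSeq ρ β n))

/-- The recursive bound `R_n = 1 - β_n (1 - c_n)`. -/
noncomputable def Rseq (ρ : ℝ) (β : ℕ → ℝ) (n : ℕ) : ℝ :=
  1 - β n * (1 - cSeq ρ β n)

/-- `V_ρ(r) = min_{β ∈ [0,1]} (1 - β + ρβ² + ρβ(r-1))`. -/
noncomputable def Vq (ρ r : ℝ) : ℝ :=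
  sInf ((fun b : ℝ => 1 - b + ρ * b ^ 2 + ρ * b * (r - 1)) '' Set.Icc 0 1)

/-- `B_ρ(r) = min{1, (1/ρ + 1 - r)/2}`, the minimizer of the quadratic over `[0,1]`. -/
noncomputable def Bq (ρ r : ℝ) : ℝ := min 1 ((1 / ρ + 1 - r) / 2)

/-- The minimax-optimal bounds: `R*₀ = 1`, `R*_n = V_ρ(R*_{n-1})`. -/
noncomputable def RStar (ρ : ℝ) : ℕ → ℝ
  | 0 => 1
  | n + 1 => Vq ρ (RStar ρ n)

/-- The minimax-optimal parameters: `β*₀ = 0`, `β*_n = B_ρ(R*_{n-1})`. -/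
noncomputable def betaStar (ρ : ℝ) : ℕ → ℝ
  | 0 => 0
  | n + 1 => Bq ρ (RStar ρ n)

lemma Bq_mem_Icc {ρ r : ℝ} (hρ : 0 < ρ) (hr : r ≤ 1) : Bq ρ r ∈ Set.Icc (0 : ℝ) 1 := by
  have h := one_div_pos.mpr hρ
  exact ⟨le_min zero_le_one (by linarith), min_le_left _ _⟩

lemma Bq_antitone (ρ : ℝ) : Antitone (Bq ρ) := fun _ _ h =>
  min_le_min_left _ (by linarith)

/-- `Bq ρ r` minimizes the quadratic defining `Vq ρ r`. -/
lemma isLeast_image_quadratic {ρ r : ℝ} (hρ : 0 < ρ) (hr : r ≤ 1) :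
    IsLeast ((fun b : ℝ => 1 - b + ρ * b ^ 2 + ρ * b * (r - 1)) '' Set.Icc 0 1)
      (1 - Bq ρ r + ρ * Bq ρ r ^ 2 + ρ * Bq ρ r * (r - 1)) := by
  refine ⟨⟨_, Bq_mem_Icc hρ hr, rfl⟩, ?_⟩
  rintro _ ⟨b, ⟨-, hb1⟩, rfl⟩
  obtain ⟨t, ht⟩ : ∃ t, t = (1 / ρ + 1 - r) / 2 := ⟨_, rfl⟩
  have hB : Bq ρ r = min 1 t := by rw [Bq, ht]
  have key : ρ * (r - 1) = 1 - 2 * ρ * t := by rw [ht]; field_simp; ring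
  have hprod : 0 ≤ (b - Bq ρ r) * (b + Bq ρ r - 2 * t) := by
    rw [hB]
    rcases le_total 1 t with h | h
    · rw [min_eq_left h]
      exact mul_nonneg_of_nonpos_of_nonpos (by linarith) (by linarith)
    · rw [min_eq_right h]
      nlinarith [sq_nonneg (b - t)]
  have := mul_nonneg hρ.le hprod
  have e : ∀ x : ℝ, ρ * x * (r - 1) = x * (1 - 2 * ρ * t) := fun x => by rw [← key]; ring
  simp only [e]
  linarith

lemma Vq_eq {ρ r : ℝ} (hρ : 0 < ρ) (hr : r ≤ 1) :
    Vq ρ r = 1 - Bq ρ r + ρ * Bq ρ r ^ 2 + ρ * Bq ρ r * (r - 1) :=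
  (isLeast_image_quadratic hρ hr).csInf_eq

lemma Vq_le {ρ r b : ℝ} (hρ : 0 < ρ) (hr : r ≤ 1) (hb : b ∈ Set.Icc (0 : ℝ) 1) :
    Vq ρ r ≤ 1 - b + ρ * b ^ 2 + ρ * b * (r - 1) := by
  rw [Vq_eq hρ hr]
  exact (isLeast_image_quadratic hρ hr).2 ⟨b, hb, rfl⟩

lemma Vq_le_one {ρ r : ℝ} (hρ : 0 < ρ) (hr : r ≤ 1) : Vq ρ r ≤ 1 := by
  simpa using Vq_le hρ hr (b := 0) (by simp)

lemma Vq_of_one_le {ρ r : ℝ} (hρ : 0 < ρ) (hr : r ≤ 1) (h : 1 ≤ (1 / ρ + 1 - r) / 2) :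
    Vq ρ r = ρ * r := by
  rw [Vq_eq hρ hr, Bq, min_eq_left h]; ring

lemma Vq_of_le_one {ρ r : ℝ} (hρ : 0 < ρ) (hr : r ≤ 1) (h : (1 / ρ + 1 - r) / 2 ≤ 1) :
    Vq ρ r = 1 - ρ * ((1 / ρ + 1 - r) / 2) ^ 2 := by
  rw [Vq_eq hρ hr, Bq, min_eq_right h]; field_simp; ring

/-- Above the fixed point `max 0 (1 - 1 / ρ)`, the map `Vq ρ` decreases but stays above it. -/
lemma Vq_mem_Ioo {ρ r : ℝ} (hρ : 0 < ρ) (hr : r ≤ 1) (h : max 0 (1 - 1 / ρ) < r) :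
    Vq ρ r ∈ Set.Ioo (max 0 (1 - 1 / ρ)) r := by
  obtain ⟨h0, h1⟩ := max_lt_iff.mp h
  have hinv : ρ * (1 / ρ) = 1 := by field_simp
  have hpos := one_div_pos.mpr hρ
  rw [Set.mem_Ioo, max_lt_iff]
  rcases lt_or_ge 1 ((1 / ρ + 1 - r) / 2) with hb | hb
  · rw [Vq_of_one_le hρ hr hb.le]
    have hi : 1 < 1 / ρ := by linarith
    have hρ1 : ρ < 1 := by nlinarith
    have := mul_pos hρ h0
    exact ⟨⟨this, by linarith⟩, by nlinarith⟩
  · rw [Vq_of_le_one hρ hr hb]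
    obtain ⟨t, ht⟩ : ∃ t, t = (1 / ρ + 1 - r) / 2 := ⟨_, rfl⟩
    rw [← ht] at hb ⊢
    clear h
    generalize 1 / ρ = i at *
    have ht0 : 0 < t := by linarith
    have hti : t < i := by linarith
    have hρt : ρ * t < 1 := by rw [← hinv]; exact mul_lt_mul_of_pos_left hti hρ
    have hsq : ρ * t ^ 2 < t := by nlinarith
    have hfix : 0 < ρ * (i - t) ^ 2 := mul_pos hρ (pow_pos (by linarith) 2)
    have hexp : ρ * (i - t) ^ 2 = i - 2 * t + ρ * t ^ 2 := by
      linear_combination (i - 2 * t) * hinv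
    exact ⟨⟨by linarith, by linarith⟩, by linarith⟩

lemma RStar_mem_Ioc {ρ : ℝ} (hρ : 0 < ρ) (n : ℕ) :
    RStar ρ n ∈ Set.Ioc (max 0 (1 - 1 / ρ)) 1 := by
  induction n with
  | zero =>
    have := one_div_pos.mpr hρ
    exact ⟨max_lt one_pos (by simp only [RStar]; linarith), le_rfl⟩
  | succ n ih => exact ⟨(Vq_mem_Ioo hρ ih.2 ih.1).1, Vq_le_one hρ ih.2⟩

lemma RStar_strictAnti {ρ : ℝ} (hρ : 0 < ρ) : StrictAnti (RStar ρ) :=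
  strictAnti_nat_of_succ_lt fun n =>
    (Vq_mem_Ioo hρ (RStar_mem_Ioc hρ n).2 (RStar_mem_Ioc hρ n).1).2

lemma betaStar_mem_Icc {ρ : ℝ} (hρ : 0 < ρ) : ∀ n, betaStar ρ n ∈ Set.Icc (0 : ℝ) 1
  | 0 => by simp [betaStar]
  | n + 1 => Bq_mem_Icc hρ (RStar_mem_Ioc hρ n).2

lemma betaStar_monotone {ρ : ℝ} (hρ : 0 < ρ) : Monotone (betaStar ρ) := by
  refine monotone_nat_of_le_succ fun n => ?_
  cases n with
  | zero => exact (betaStar_mem_Icc hρ 1).1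
  | succ n => exact Bq_antitone ρ (RStar_strictAnti hρ (Nat.lt_succ_self n)).le

lemma cSeq_le_one (ρ : ℝ) (β : ℕ → ℝ) : ∀ n, cSeq ρ β n ≤ 1
  | 0 => zero_le_one
  | _ + 1 => min_le_left _ _

lemma RStar_le_Rseq {ρ : ℝ} (hρ : 0 < ρ) {β : ℕ → ℝ} (h0 : β 0 = 0)
    (hβ : ∀ i, β i ∈ Set.Icc (0 : ℝ) 1) (n : ℕ) : RStar ρ n ≤ Rseq ρ β n := by
  induction n with
  | zero => simp [RStar, Rseq, h0]
  | succ n ih =>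
    have hc := cSeq_le_one ρ β n
    have hb := hβ (n + 1)
    have hd : β (n + 1) + (Rseq ρ β n - 1) ≤
        |β n - β (n + 1)| + min (β n) (β (n + 1)) * cSeq ρ β n := by
      rw [Rseq]
      rcases le_total (β n) (β (n + 1)) with h | h
      · rw [min_eq_left h, abs_of_nonpos (by linarith)]; linarith
      · rw [min_eq_right h, abs_of_nonneg (by linarith)]; nlinarith
    have hr := (RStar_mem_Ioc hρ n).2
    rw [RStar, Rseq, cSeq]
    rcases min_choice 1 (ρ * (|β n - β (n + 1)| + min (β n) (β (n + 1)) * cSeq ρ β n))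
      with h | h <;> rw [h]
    · simpa using Vq_le_one hρ hr
    · have := mul_le_mul_of_nonneg_left
        ((add_le_add_right (sub_le_sub_right ih 1) (β (n + 1))).trans hd)
        (mul_nonneg hb.1 hρ.le)
      refine (Vq_le hρ hr hb).trans ?_
      linarith

lemma Rseq_betaStar {ρ : ℝ} (hρ : 0 < ρ) (n : ℕ) : Rseq ρ (betaStar ρ) n = RStar ρ n := by
  induction n with
  | zero => simp [RStar, Rseq, betaStar]
  | succ n ih =>
    have hmono := betaStar_monotone hρ (Nat.le_succ n)
    have hr := (RStar_mem_Ioc hρ n).2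
    have hpos := one_div_pos.mpr hρ
    have hd : |betaStar ρ n - betaStar ρ (n + 1)| +
        min (betaStar ρ n) (betaStar ρ (n + 1)) * cSeq ρ (betaStar ρ) n =
        betaStar ρ (n + 1) + (RStar ρ n - 1) := by
      rw [← ih, Rseq, min_eq_left hmono, abs_of_nonpos (sub_nonpos.mpr hmono)]; ring
    have hB : betaStar ρ (n + 1) ≤ (1 / ρ + 1 - RStar ρ n) / 2 := min_le_right _ _
    have hle : ρ * (betaStar ρ (n + 1) + (RStar ρ n - 1)) ≤ 1 := by
      rw [← le_div_iff₀' hρ]; linarith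
    rw [Rseq, cSeq, hd, min_eq_right hle, RStar, Vq_eq hρ hr]
    simp only [betaStar]
    ring

lemma betaStar_succ {ρ : ℝ} (hρ : 0 < ρ) (n : ℕ) :
    betaStar ρ (n + 1) = min 1 ((1 + (ρ * betaStar ρ n) ^ 2) / (2 * ρ)) := by
  cases n with
  | zero => simp [betaStar, Bq, RStar]; ring_nf
  | succ n =>
    have hr := (RStar_mem_Ioc hρ n).2
    rcases le_total 1 ((1 / ρ + 1 - RStar ρ n) / 2) with h | h
    · have h1 : betaStar ρ (n + 1) = 1 := min_eq_left h
      have h2 : betaStar ρ (n + 2) = 1 :=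
        le_antisymm (betaStar_mem_Icc hρ _).2 (h1 ▸ betaStar_monotone hρ (Nat.le_succ _))
      rw [h2, h1, min_eq_left]
      rw [le_div_iff₀ (by positivity)]
      nlinarith [sq_nonneg (ρ - 1)]
    · have h1 : betaStar ρ (n + 1) = (1 / ρ + 1 - RStar ρ n) / 2 := min_eq_right h
      have h2 : RStar ρ (n + 1) = 1 - ρ * betaStar ρ (n + 1) ^ 2 := by
        rw [h1, RStar, Vq_of_le_one hρ hr h]
      rw [betaStar, Bq, h2]
      congr 1
      field_simp
      ring

lemma tendsto_RStar {ρ : ℝ} (hρ : 0 < ρ) :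
    Filter.Tendsto (RStar ρ) Filter.atTop (nhds (max 0 (1 - 1 / ρ))) := by
  have hlim := tendsto_atTop_ciInf (RStar_strictAnti hρ).antitone
    ⟨max 0 (1 - 1 / ρ), by rintro _ ⟨n, rfl⟩; exact (RStar_mem_Ioc hρ n).1.le⟩
  obtain ⟨L, hL⟩ : ∃ L, L = ⨅ n, RStar ρ n := ⟨_, rfl⟩
  rw [← hL] at hlim
  have hL1 : L ≤ 1 := le_of_tendsto' hlim fun n => (RStar_mem_Ioc hρ n).2
  have hLr : max 0 (1 - 1 / ρ) ≤ L := ge_of_tendsto' hlim fun n => (RStar_mem_Ioc hρ n).1.le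
  have hcont : Continuous fun r => 1 - Bq ρ r + ρ * Bq ρ r ^ 2 + ρ * Bq ρ r * (r - 1) := by
    unfold Bq
    fun_prop
  have hV : Vq ρ L = L := by
    rw [Vq_eq hρ hL1]
    refine tendsto_nhds_unique ((hcont.tendsto L).comp hlim)
      (((Filter.tendsto_add_atTop_iff_nat 1).mpr hlim).congr fun n => ?_)
    exact Vq_eq hρ (RStar_mem_Ioc hρ n).2
  rcases hLr.eq_or_lt with h | h
  · rwa [h]
  · exact absurd (Vq_mem_Ioo hρ hL1 h).2 hV.not_lt

/-- (i) for every `n ≥ 1`, `R*_n` is the global minimum of `R_n(β₁,…,β_n)` over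
`[0,1]^n`, attained at `(β*₁,…,β*_n)`; (ii) `β*_n = min{1, (1 + (ρ β*_{n-1})²)/(2ρ)}`;
(iii) `(R*_n)` is strictly decreasing and converges to `r_ρ = max{0, 1 - 1/ρ}`. -/
theorem minimax_optimal_halpern (ρ : ℝ) (hρ : 0 < ρ) :
    (∀ i : ℕ, betaStar ρ i ∈ Set.Icc (0 : ℝ) 1) ∧
    (∀ n : ℕ, 1 ≤ n →
      Rseq ρ (betaStar ρ) n = RStar ρ n ∧
      IsLeast {r : ℝ | ∃ β : ℕ → ℝ, β 0 = 0 ∧ (∀ i, β i ∈ Set.Icc (0 : ℝ) 1) ∧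
        r = Rseq ρ β n} (RStar ρ n)) ∧
    (∀ n : ℕ, 1 ≤ n →
      betaStar ρ n = min 1 ((1 + (ρ * betaStar ρ (n - 1)) ^ 2) / (2 * ρ))) ∧
    StrictAnti (RStar ρ) ∧
    Filter.Tendsto (RStar ρ) Filter.atTop (nhds (max 0 (1 - 1 / ρ))) := by
  refine ⟨betaStar_mem_Icc hρ, fun n _ => ⟨Rseq_betaStar hρ n, ?_, ?_⟩, ?_,
    RStar_strictAnti hρ, tendsto_RStar hρ⟩
  · exact ⟨betaStar ρ, rfl, betaStar_mem_Icc hρ, (Rseq_betaStar hρ n).symm⟩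
  · rintro _ ⟨β, h0, hβ, rfl⟩
    exact RStar_le_Rseq hρ h0 hβ n
  · rintro (_ | n) hn
    · omega
    · exact betaStar_succ hρ n
end

section
/- Let T : C → C be ρ-Lipschitz (ρ > 0) on a nonempty convex subset C of a real normed space with a fixed point x* = T x*, let δ₀ ≥ ‖x⁰ − x*‖, and let (x^n) be the ♭-opt-halpern iterates: R♭₀ = 1+ρ, β♭_n = B♭_ρ(R♭_{n−1}), R♭_n = V♭_ρ(R♭_{n−1}), x^n = (1−β♭_n)x⁰ + β♭_n T x^{n−1}. Then for all n ≥ 1 one has ‖x^n − T x^n‖ ≤ δ₀ R♭_n; moreover (R♭_n) is non-increasing with limit r♭ and (β♭_n) is non-decreasing with limit β♭_ρ, where r♭ = 0 and β♭_ρ = 1 if ρ < 1; r♭ = (√2+1)²(1 − 1/ρ) and β♭_ρ = (√2+1−ρ)/(ρ√2) if 1 ≤ ρ ≤ √2+1; r♭ = 1+ρ and β♭_ρ = 0 if ρ > √2+1. -/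
/-- `V♭_ρ(r) = min_{β ∈ [0,1]} ((1+ρ) - (1+3ρ)β + 2ρβ² + ρβr)`. -/
noncomputable def Vflat (ρ r : ℝ) : ℝ :=
  sInf ((fun b : ℝ => (1 + ρ) - (1 + 3 * ρ) * b + 2 * ρ * b ^ 2 + ρ * b * r) '' Set.Icc 0 1)

/-- `B♭_ρ(r)`: the minimizer of the quadratic over `[0,1]`; equals `1` if `r ≤ 1/ρ - 1`,
`(1/ρ + 3 - r)/4` if `1/ρ - 1 ≤ r ≤ 1/ρ + 3`, and `0` if `r ≥ 1/ρ + 3`. -/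
noncomputable def Bflat (ρ r : ℝ) : ℝ :=
  if r ≤ 1 / ρ - 1 then 1 else if r ≤ 1 / ρ + 3 then (1 / ρ + 3 - r) / 4 else 0

/-- The ♭-opt-halpern bounds: `R♭₀ = 1 + ρ`, `R♭_n = V♭_ρ(R♭_{n-1})`. -/
noncomputable def RflStar (ρ : ℝ) : ℕ → ℝ
  | 0 => 1 + ρ
  | n + 1 => Vflat ρ (RflStar ρ n)

/-- The limit value `r♭`. -/
noncomputable def rFlatLim (ρ : ℝ) : ℝ :=
  if ρ < 1 then 0
  else if ρ ≤ Real.sqrt 2 + 1 then (Real.sqrt 2 + 1) ^ 2 * (1 - 1 / ρ)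
  else 1 + ρ

/-- The limit value `β♭_ρ`. -/
noncomputable def betaFlatLim (ρ : ℝ) : ℝ :=
  if ρ < 1 then 1
  else if ρ ≤ Real.sqrt 2 + 1 then (Real.sqrt 2 + 1 - ρ) / (ρ * Real.sqrt 2)
  else 0

/-- The quadratic in `b` whose minimum over `[0,1]` is `Vflat ρ r`. -/
noncomputable def quadFlat (ρ r b : ℝ) : ℝ :=
  (1 + ρ) - (1 + 3 * ρ) * b + 2 * ρ * b ^ 2 + ρ * b * r

lemma Bflat_eq_max_min (ρ r : ℝ) : Bflat ρ r = max 0 (min 1 ((1 / ρ + 3 - r) / 4)) := by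
  unfold Bflat
  split_ifs with h₁ h₂
  · rw [min_eq_left (by linarith), max_eq_right zero_le_one]
  · rw [min_eq_right (by linarith), max_eq_right (by linarith)]
  · rw [min_eq_right (by linarith), max_eq_left (by linarith)]

lemma Bflat_nonneg (ρ r : ℝ) : 0 ≤ Bflat ρ r := by
  rw [Bflat_eq_max_min]
  exact le_max_left _ _

lemma Bflat_le_one (ρ r : ℝ) : Bflat ρ r ≤ 1 := by
  rw [Bflat_eq_max_min]
  exact max_le zero_le_one (min_le_left _ _)

lemma antitone_Bflat (ρ : ℝ) : Antitone (Bflat ρ) := by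
  intro r s h
  simp only [Bflat_eq_max_min]
  gcongr

lemma continuous_Bflat (ρ : ℝ) : Continuous (Bflat ρ) := by
  rw [funext (Bflat_eq_max_min ρ)]
  fun_prop

lemma quadFlat_Bflat_le {ρ : ℝ} (hρ : 0 < ρ) (r : ℝ) {b : ℝ} (hb₀ : 0 ≤ b) (hb₁ : b ≤ 1) :
    quadFlat ρ r (Bflat ρ r) ≤ quadFlat ρ r b := by
  have hinv : ρ * (1 / ρ) = 1 := by field_simp
  suffices h : 0 ≤ ρ * ((b - Bflat ρ r) * (2 * (b + Bflat ρ r) - (1 / ρ + 3 - r))) by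
    unfold quadFlat
    linear_combination h - (b - Bflat ρ r) * hinv
  refine mul_nonneg hρ.le ?_
  unfold Bflat
  split_ifs with h₁ h₂
  · exact mul_nonneg_of_nonpos_of_nonpos (by linarith) (by linarith)
  · nlinarith [sq_nonneg (b - (1 / ρ + 3 - r) / 4)]
  · exact mul_nonneg (by linarith) (by linarith)

lemma Vflat_eq_quadFlat {ρ : ℝ} (hρ : 0 < ρ) (r : ℝ) :
    Vflat ρ r = quadFlat ρ r (Bflat ρ r) := by
  refine IsLeast.csInf_eq ⟨⟨_, ⟨Bflat_nonneg ρ r, Bflat_le_one ρ r⟩, rfl⟩, ?_⟩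
  rintro _ ⟨b, hb, rfl⟩
  exact quadFlat_Bflat_le hρ r hb.1 hb.2

lemma Vflat_le_quadFlat {ρ : ℝ} (hρ : 0 < ρ) (r : ℝ) {b : ℝ} (hb₀ : 0 ≤ b) (hb₁ : b ≤ 1) :
    Vflat ρ r ≤ quadFlat ρ r b :=
  (Vflat_eq_quadFlat hρ r).trans_le (quadFlat_Bflat_le hρ r hb₀ hb₁)

lemma monotone_Vflat {ρ : ℝ} (hρ : 0 < ρ) : Monotone (Vflat ρ) := by
  intro r s h
  refine (Vflat_le_quadFlat hρ r (Bflat_nonneg ρ s) (Bflat_le_one ρ s)).trans ?_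
  rw [Vflat_eq_quadFlat hρ s]
  unfold quadFlat
  gcongr
  exact mul_nonneg hρ.le (Bflat_nonneg ρ s)

lemma continuous_Vflat {ρ : ℝ} (hρ : 0 < ρ) : Continuous (Vflat ρ) := by
  rw [funext (Vflat_eq_quadFlat hρ)]
  have := continuous_Bflat ρ
  unfold quadFlat
  fun_prop

lemma antitone_RflStar {ρ : ℝ} (hρ : 0 < ρ) : Antitone (RflStar ρ) := by
  refine antitone_nat_of_succ_le fun n => ?_
  induction n with
  | zero =>
    refine (Vflat_le_quadFlat hρ _ le_rfl zero_le_one).trans_eq ?_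
    simp [quadFlat, RflStar]
  | succ n ih => exact monotone_Vflat hρ ih

lemma monotone_Bflat_RflStar {ρ : ℝ} (hρ : 0 < ρ) :
    Monotone fun n : ℕ => Bflat ρ (RflStar ρ n) :=
  (antitone_Bflat ρ).comp (antitone_RflStar hρ)

lemma one_add_le_iff_le_sqrt_two_add_one {ρ : ℝ} (hρ : 0 < ρ) :
    1 + ρ ≤ 1 / ρ + 3 ↔ ρ ≤ Real.sqrt 2 + 1 := by
  have h₁ : 1 + ρ ≤ 1 / ρ + 3 ↔ (ρ - 1) ^ 2 ≤ 2 := by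
    rw [← sub_le_iff_le_add, le_div_iff₀ hρ]
    constructor <;> intro h <;> linarith
  rw [h₁]
  have hs := Real.sq_sqrt (zero_le_two : (0 : ℝ) ≤ 2)
  have hs₁ : 1 ≤ Real.sqrt 2 := Real.one_le_sqrt.2 one_le_two
  constructor <;> intro h <;> nlinarith

lemma rFlatLim_le {ρ : ℝ} (hρ : 0 < ρ) : rFlatLim ρ ≤ 1 + ρ := by
  unfold rFlatLim
  split_ifs with h₁ h₂
  · linarith
  · have hs := Real.sq_sqrt (zero_le_two : (0 : ℝ) ≤ 2)
    have hinv : ρ * (1 / ρ) = 1 := by field_simp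
    refine le_of_mul_le_mul_left ?_ hρ
    nlinarith [sq_nonneg (ρ - 1 - Real.sqrt 2)]
  · rfl

lemma Bflat_rFlatLim {ρ : ℝ} (hρ : 0 < ρ) : Bflat ρ (rFlatLim ρ) = betaFlatLim ρ := by
  have hs := Real.sq_sqrt (zero_le_two : (0 : ℝ) ≤ 2)
  have hle := rFlatLim_le hρ
  have hiff := one_add_le_iff_le_sqrt_two_add_one hρ
  unfold rFlatLim betaFlatLim at *
  split_ifs at * with h₁ h₂
  · exact if_pos (by rw [sub_nonneg, le_div_iff₀ hρ]; linarith)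
  · have hle₃ := hle.trans (hiff.2 h₂)
    have hone : 1 / ρ ≤ 1 := by rw [div_le_one hρ]; linarith
    have hnn : 0 ≤ (Real.sqrt 2 + 1) ^ 2 * (1 - 1 / ρ) :=
      mul_nonneg (sq_nonneg _) (by linarith)
    rw [Bflat_eq_max_min, min_eq_right (by linarith), max_eq_right (by linarith)]
    field_simp
    linear_combination (-Real.sqrt 2 * (ρ - 1) + 2 * (1 - ρ)) * hs
  · have h := lt_of_not_ge (mt hiff.1 h₂)
    rw [Bflat_eq_max_min, min_eq_right (by linarith), max_eq_left (by linarith)]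

lemma Vflat_rFlatLim {ρ : ℝ} (hρ : 0 < ρ) : Vflat ρ (rFlatLim ρ) = rFlatLim ρ := by
  have hs := Real.sq_sqrt (zero_le_two : (0 : ℝ) ≤ 2)
  rw [Vflat_eq_quadFlat hρ, Bflat_rFlatLim hρ]
  unfold quadFlat rFlatLim betaFlatLim
  split_ifs
  · ring
  · obtain ⟨s, hsdef⟩ : ∃ s, s = Real.sqrt 2 := ⟨_, rfl⟩
    rw [← hsdef] at hs ⊢
    have hs₀ : s ≠ 0 := by rintro rfl; norm_num at hs
    field_simp
    grind
  · ring

lemma Vflat_lt_self {ρ r : ℝ} (hρ : 0 < ρ) (hr : rFlatLim ρ < r) (hr' : r ≤ 1 + ρ) :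
    Vflat ρ r < r := by
  have hs := Real.sq_sqrt (zero_le_two : (0 : ℝ) ≤ 2)
  have hs₀ := Real.sqrt_nonneg 2
  have hiff := one_add_le_iff_le_sqrt_two_add_one hρ
  unfold rFlatLim at hr
  split_ifs at hr with h₁ h₂
  · refine (Vflat_le_quadFlat hρ r zero_le_one le_rfl).trans_lt ?_
    unfold quadFlat
    nlinarith
  · have hle₃ := hr'.trans (hiff.2 h₂)
    have hinv : ρ * (1 / ρ) = 1 := by field_simp
    have hone : 1 / ρ ≤ 1 := by rw [div_le_one hρ]; linarith
    have hnn : 0 ≤ (Real.sqrt 2 + 1) ^ 2 * (1 - 1 / ρ) :=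
      mul_nonneg (sq_nonneg _) (by linarith)
    refine (Vflat_le_quadFlat hρ r (b := (1 / ρ + 3 - r) / 4)
      (by linarith) (by linarith)).trans_lt ?_
    have hbig : (Real.sqrt 2 + 1) ^ 2 * (ρ - 1) < ρ * r := by
      have := mul_lt_mul_of_pos_left hr hρ
      linear_combination this + (Real.sqrt 2 + 1) ^ 2 * hinv
    have hprod : 0 < (ρ * r - (3 + 2 * Real.sqrt 2) * (ρ - 1)) *
        (ρ * r - (3 - 2 * Real.sqrt 2) * (ρ - 1)) := by
      apply mul_pos <;> nlinarith
    have hkey : 8 * ρ * (r - quadFlat ρ r ((1 / ρ + 3 - r) / 4)) =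
        (ρ * r - (3 + 2 * Real.sqrt 2) * (ρ - 1)) *
        (ρ * r - (3 - 2 * Real.sqrt 2) * (ρ - 1)) := by
      unfold quadFlat
      field_simp
      grind
    rw [← hkey] at hprod
    exact sub_pos.1 (pos_of_mul_pos_right hprod (by positivity))
  · exact absurd hr hr'.not_gt

lemma rFlatLim_le_RflStar {ρ : ℝ} (hρ : 0 < ρ) (n : ℕ) : rFlatLim ρ ≤ RflStar ρ n := by
  induction n with
  | zero => exact rFlatLim_le hρ
  | succ n ih => exact (Vflat_rFlatLim hρ).symm.trans_le (monotone_Vflat hρ ih)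

lemma tendsto_RflStar {ρ : ℝ} (hρ : 0 < ρ) :
    Filter.Tendsto (RflStar ρ) Filter.atTop (nhds (rFlatLim ρ)) := by
  have hbdd : BddBelow (Set.range (RflStar ρ)) :=
    ⟨rFlatLim ρ, by rintro _ ⟨n, rfl⟩; exact rFlatLim_le_RflStar hρ n⟩
  have hlim := tendsto_atTop_ciInf (antitone_RflStar hρ) hbdd
  set L := ⨅ n, RflStar ρ n
  have hfix : Vflat ρ L = L :=
    tendsto_nhds_unique (((continuous_Vflat hρ).tendsto L).comp hlim)
      (hlim.comp (Filter.tendsto_add_atTop_nat 1))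
  have hge : rFlatLim ρ ≤ L := le_ciInf (rFlatLim_le_RflStar hρ)
  rcases hge.eq_or_lt with h | h
  · rwa [h]
  · exact absurd hfix (Vflat_lt_self hρ h (ciInf_le hbdd 0)).ne

/-- Bounds on `‖x n - xstar‖` along the iterates, relative to `‖x 0 - xstar‖`. -/
noncomputable def SflStar (ρ : ℝ) : ℕ → ℝ
  | 0 => 1
  | n + 1 => (1 - Bflat ρ (RflStar ρ n)) + Bflat ρ (RflStar ρ n) * (ρ * SflStar ρ n)

lemma RflStar_succ_eq {ρ : ℝ} (hρ : 0 < ρ) (n : ℕ) :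
    RflStar ρ (n + 1) =
      (1 - Bflat ρ (RflStar ρ n)) * (1 + ρ * SflStar ρ (n + 1)) +
        Bflat ρ (RflStar ρ n) * (ρ * (RflStar ρ n -
          (1 - Bflat ρ (RflStar ρ n)) * (1 + ρ * SflStar ρ n))) := by
  simp only [RflStar, SflStar, Vflat_eq_quadFlat hρ, quadFlat]
  ring

section Iterates

variable {E : Type*} [NormedAddCommGroup E] [NormedSpace ℝ E] {C : Set E} {ρ : ℝ} {T : E → E}
  {xstar : E} {x : ℕ → E} {δ₀ : ℝ}

lemma halpern_mem (hCconv : Convex ℝ C) (hTmaps : Set.MapsTo T C C) (hx0 : x 0 ∈ C)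
    (hx : ∀ n : ℕ, x (n + 1) =
      (1 - Bflat ρ (RflStar ρ n)) • x 0 + Bflat ρ (RflStar ρ n) • T (x n)) (n : ℕ) :
    x n ∈ C := by
  induction n with
  | zero => exact hx0
  | succ n ih =>
    rw [hx]
    exact hCconv hx0 (hTmaps ih) (sub_nonneg.2 (Bflat_le_one _ _)) (Bflat_nonneg _ _) (by ring)

lemma norm_smul_add_smul_le {a b A B : ℝ} {u v : E} (ha : 0 ≤ a) (hb : 0 ≤ b)
    (hu : ‖u‖ ≤ A) (hv : ‖v‖ ≤ B) : ‖a • u + b • v‖ ≤ a * A + b * B := by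
  refine (norm_add_le _ _).trans ?_
  rw [norm_smul_of_nonneg ha, norm_smul_of_nonneg hb]
  gcongr

variable (hρ : 0 < ρ) (hTlip : ∀ x ∈ C, ∀ y ∈ C, ‖T x - T y‖ ≤ ρ * ‖x - y‖)
  (hxstarC : xstar ∈ C) (hxstar : T xstar = xstar) (hxC : ∀ n, x n ∈ C)
  (hx : ∀ n : ℕ, x (n + 1) =
    (1 - Bflat ρ (RflStar ρ n)) • x 0 + Bflat ρ (RflStar ρ n) • T (x n))
  (hδ₀ : ‖x 0 - xstar‖ ≤ δ₀)

include hρ hTlip hxstarC hxstar hxC hx hδ₀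

lemma norm_halpern_sub_le (n : ℕ) : ‖x n - xstar‖ ≤ δ₀ * SflStar ρ n := by
  induction n with
  | zero => simpa [SflStar] using hδ₀
  | succ n ih =>
    have hT : ‖T (x n) - xstar‖ ≤ ρ * (δ₀ * SflStar ρ n) := by
      have h := hTlip _ (hxC n) _ hxstarC
      rw [hxstar] at h
      exact h.trans (by gcongr)
    have hsplit : x (n + 1) - xstar = (1 - Bflat ρ (RflStar ρ n)) • (x 0 - xstar) +
        Bflat ρ (RflStar ρ n) • (T (x n) - xstar) := by
      rw [hx]; module
    rw [hsplit]
    refine (norm_smul_add_smul_le (sub_nonneg.2 (Bflat_le_one _ _)) (Bflat_nonneg _ _)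
      hδ₀ hT).trans_eq ?_
    rw [SflStar]; ring

lemma norm_sub_map_halpern_le (n : ℕ) : ‖x 0 - T (x n)‖ ≤ δ₀ * (1 + ρ * SflStar ρ n) := by
  have h := hTlip _ hxstarC _ (hxC n)
  rw [hxstar, norm_sub_rev xstar (x n)] at h
  have hs := mul_le_mul_of_nonneg_left
    (norm_halpern_sub_le hρ hTlip hxstarC hxstar hxC hx hδ₀ n) hρ.le
  linarith [norm_sub_le_norm_sub_add_norm_sub (x 0) xstar (T (x n))]

lemma norm_halpern_succ_sub_le (n : ℕ) :
    ‖x (n + 1) - x n‖ ≤ δ₀ * (RflStar ρ n -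
      (1 - Bflat ρ (RflStar ρ n)) * (1 + ρ * SflStar ρ n)) := by
  induction n with
  | zero =>
    have h := norm_sub_map_halpern_le hρ hTlip hxstarC hxstar hxC hx hδ₀ 0
    have hsplit : x (0 + 1) - x 0 = (-Bflat ρ (RflStar ρ 0)) • (x 0 - T (x 0)) := by
      rw [hx]; module
    rw [hsplit, norm_smul, norm_neg, Real.norm_of_nonneg (Bflat_nonneg _ _)]
    refine (mul_le_mul_of_nonneg_left h (Bflat_nonneg _ _)).trans_eq ?_
    simp only [SflStar, RflStar]
    ring
  | succ n ih =>
    have h := norm_sub_map_halpern_le hρ hTlip hxstarC hxstar hxC hx hδ₀ (n + 1)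
    have hT := (hTlip _ (hxC (n + 1)) _ (hxC n)).trans (mul_le_mul_of_nonneg_left ih hρ.le)
    have hmono : Bflat ρ (RflStar ρ n) ≤ Bflat ρ (RflStar ρ (n + 1)) :=
      monotone_Bflat_RflStar hρ n.le_succ
    have hsplit : x (n + 1 + 1) - x (n + 1) =
        (Bflat ρ (RflStar ρ (n + 1)) - Bflat ρ (RflStar ρ n)) • (T (x (n + 1)) - x 0) +
          Bflat ρ (RflStar ρ n) • (T (x (n + 1)) - T (x n)) := by
      rw [hx (n + 1), hx n]; module
    rw [norm_sub_rev] at h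
    rw [hsplit]
    refine (norm_smul_add_smul_le (sub_nonneg.2 hmono) (Bflat_nonneg _ _) h hT).trans_eq ?_
    linear_combination -δ₀ * RflStar_succ_eq hρ n

lemma norm_halpern_sub_map_le (n : ℕ) :
    ‖x (n + 1) - T (x (n + 1))‖ ≤ δ₀ * RflStar ρ (n + 1) := by
  have h := norm_sub_map_halpern_le hρ hTlip hxstarC hxstar hxC hx hδ₀ (n + 1)
  have hT := (hTlip _ (hxC (n + 1)) _ (hxC n)).trans (mul_le_mul_of_nonneg_left
    (norm_halpern_succ_sub_le hρ hTlip hxstarC hxstar hxC hx hδ₀ n) hρ.le)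
  have hsplit : x (n + 1) - T (x (n + 1)) =
      (1 - Bflat ρ (RflStar ρ n)) • (x 0 - T (x (n + 1))) +
        Bflat ρ (RflStar ρ n) • (T (x n) - T (x (n + 1))) := by
    nth_rewrite 1 [hx n]; module
  rw [norm_sub_rev] at hT
  rw [hsplit]
  refine (norm_smul_add_smul_le (sub_nonneg.2 (Bflat_le_one _ _)) (Bflat_nonneg _ _)
    h hT).trans_eq ?_
  rw [RflStar_succ_eq hρ n]; ring

end Iterates

/-- for a `ρ`-Lipschitz self-map with a fixed point `x*`, `δ₀ ≥ ‖x⁰ - x*‖`, and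
the ♭-opt-halpern iterates `x^n = (1 - β♭_n) x⁰ + β♭_n T x^{n-1}` with `β♭_n = B♭_ρ(R♭_{n-1})`,
one has `‖x^n - T x^n‖ ≤ δ₀ R♭_n` for `n ≥ 1`; moreover `(R♭_n)` is non-increasing with limit
`r♭` and `(β♭_n)` is non-decreasing with limit `β♭_ρ`. -/
theorem flat_opt_halpern
    {E : Type*} [NormedAddCommGroup E] [NormedSpace ℝ E]
    {C : Set E} (hCne : C.Nonempty) (hCconv : Convex ℝ C)
    {ρ : ℝ} (hρ : 0 < ρ)
    {T : E → E} (hTmaps : Set.MapsTo T C C)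
    (hTlip : ∀ x ∈ C, ∀ y ∈ C, ‖T x - T y‖ ≤ ρ * ‖x - y‖)
    (xstar : E) (hxstarC : xstar ∈ C) (hxstar : T xstar = xstar)
    (x : ℕ → E) (hx0 : x 0 ∈ C)
    (hx : ∀ n : ℕ, x (n + 1) =
      (1 - Bflat ρ (RflStar ρ n)) • x 0 + Bflat ρ (RflStar ρ n) • T (x n))
    (δ₀ : ℝ) (hδ₀ : ‖x 0 - xstar‖ ≤ δ₀) :
    (∀ n : ℕ, ‖x (n + 1) - T (x (n + 1))‖ ≤ δ₀ * RflStar ρ (n + 1)) ∧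
    Antitone (RflStar ρ) ∧
    Filter.Tendsto (RflStar ρ) Filter.atTop (nhds (rFlatLim ρ)) ∧
    Monotone (fun n : ℕ => Bflat ρ (RflStar ρ n)) ∧
    Filter.Tendsto (fun n : ℕ => Bflat ρ (RflStar ρ n)) Filter.atTop
      (nhds (betaFlatLim ρ)) := by
  have hxC := halpern_mem hCconv hTmaps hx0 hx
  exact ⟨norm_halpern_sub_map_le hρ hTlip hxstarC hxstar hxC hx hδ₀, antitone_RflStar hρ,
    tendsto_RflStar hρ, monotone_Bflat_RflStar hρ,
    Bflat_rFlatLim hρ ▸ ((continuous_Bflat ρ).tendsto _).comp (tendsto_RflStar hρ)⟩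
end
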